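/- Let α, β, γ, δ ∈ ℂ be algebraically independent over ℚ. Let L be a differential field extension of ℂ(t) with derivation D, K a differential subfield of L, and let y ∈ L with y ∉ {0, 1, t} satisfy the sixth Painlevé equation y'' = (1/2)(1/y + 1/(y−1) + 1/(y−t))(y')² − (1/t + 1/(t−1) + 1/(y−t))y' + (y(y−1)(y−t)/(t²(t−1)²))·(α + β·t/y² + γ·(t−1)/(y−1)² + δ·t(t−1)/(y−t)²). Then either y is algebraic over K, or y and y' are algebraically independent over K. (Strong minimality part of Proposition 3.18 for generic P_VI.) -/

import Mathlib

namespace PainleveSix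

open Polynomial

section IntegerCoefficients

variable {R : Type*} [CommRing R]

/-- The coefficient of a polynomial at an integer exponent (zero at negative exponents). -/
noncomputable def zcoeff (f : R[X]) (i : ℤ) : R :=
  if 0 ≤ i then f.coeff i.toNat else 0

lemma zcoeff_natCast (f : R[X]) (n : ℕ) : zcoeff f n = f.coeff n := by simp [zcoeff]

lemma zcoeff_of_neg (f : R[X]) {i : ℤ} (hi : i < 0) : zcoeff f i = 0 := by
  simp [zcoeff, not_le.mpr hi]

@[simp] lemma zcoeff_zero (i : ℤ) : zcoeff (0 : R[X]) i = 0 := by simp [zcoeff]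

@[simp] lemma zcoeff_add (f g : R[X]) (i : ℤ) : zcoeff (f + g) i = zcoeff f i + zcoeff g i := by
  unfold zcoeff; split_ifs <;> simp

@[simp] lemma zcoeff_sub (f g : R[X]) (i : ℤ) : zcoeff (f - g) i = zcoeff f i - zcoeff g i := by
  unfold zcoeff; split_ifs <;> simp

@[simp] lemma zcoeff_neg (f : R[X]) (i : ℤ) : zcoeff (-f) i = -zcoeff f i := by
  unfold zcoeff; split_ifs <;> simp

@[simp] lemma zcoeff_C_mul (a : R) (f : R[X]) (i : ℤ) : zcoeff (C a * f) i = a * zcoeff f i := by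
  unfold zcoeff; split_ifs <;> simp

@[simp] lemma zcoeff_X_mul (f : R[X]) (i : ℤ) : zcoeff (X * f) i = zcoeff f (i - 1) := by
  rcases lt_trichotomy i 0 with hi | rfl | hi
  · rw [zcoeff_of_neg _ hi, zcoeff_of_neg _ (by omega)]
  · simp [zcoeff]
  · obtain ⟨n, rfl⟩ : ∃ n : ℕ, i = n + 1 := ⟨(i - 1).toNat, by omega⟩
    rw [add_sub_cancel_right, zcoeff_natCast]
    exact_mod_cast (zcoeff_natCast (X * f) (n + 1)).trans (coeff_X_mul f n)

@[simp] lemma zcoeff_derivative (f : R[X]) (i : ℤ) :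
    zcoeff (derivative f) i = (i + 1) * zcoeff f (i + 1) := by
  rcases lt_trichotomy i (-1) with hi | rfl | hi
  · rw [zcoeff_of_neg _ (by omega), zcoeff_of_neg _ (by omega), mul_zero]
  · simp [zcoeff]
  · obtain ⟨n, rfl⟩ : ∃ n : ℕ, i = n := ⟨i.toNat, by omega⟩
    have := zcoeff_natCast f (n + 1)
    push_cast at this ⊢
    rw [zcoeff_natCast, coeff_derivative, this, mul_comm]

lemma zcoeff_of_natDegree_lt (f : R[X]) {i : ℤ} (hi : (f.natDegree : ℤ) < i) : zcoeff f i = 0 := by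
  rw [zcoeff, if_pos (by omega), coeff_eq_zero_of_natDegree_lt (by omega)]

lemma natDegree_le_of_zcoeff (f : R[X]) (n : ℕ) (h : ∀ i : ℤ, n < i → zcoeff f i = 0) :
    f.natDegree ≤ n := by
  rw [natDegree_le_iff_coeff_eq_zero]
  intro i hi
  rw [← zcoeff_natCast]
  exact h _ (by exact_mod_cast hi)

lemma ext_zcoeff {f g : R[X]} (h : ∀ i : ℤ, zcoeff f i = zcoeff g i) : f = g := by
  ext n
  simpa only [zcoeff_natCast] using h n

end IntegerCoefficients

section CoefficientMap

variable {A : Type*} [CommRing A]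

/-- The additive map of `A[X]` acting on coefficients through `d`. -/
noncomputable def coeffMap (d : A →+ A) : A[X] →+ A[X] where
  toFun f := f.sum fun n a => monomial n (d a)
  map_zero' := by simp
  map_add' f g := sum_add_index f g _ (by simp) (by simp)

@[simp] lemma coeff_coeffMap (d : A →+ A) (f : A[X]) (i : ℕ) :
    (coeffMap d f).coeff i = d (f.coeff i) := by
  by_cases h : f.coeff i = 0 <;>
    simp [coeffMap, sum_def, coeff_monomial, h]

@[simp] lemma zcoeff_coeffMap (d : A →+ A) (f : A[X]) (i : ℤ) :
    zcoeff (coeffMap d f) i = d (zcoeff f i) := by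
  unfold zcoeff; split_ifs <;> simp

@[simp] lemma coeffMap_C (d : A →+ A) (a : A) : coeffMap d (C a) = C (d a) := by
  ext n; rw [coeff_coeffMap, coeff_C, coeff_C]; split_ifs <;> simp

lemma coeffMap_monomial (d : A →+ A) (n : ℕ) (a : A) :
    coeffMap d (monomial n a) = monomial n (d a) := by
  ext i; rw [coeff_coeffMap, coeff_monomial, coeff_monomial]; split_ifs <;> simp

lemma coeffMap_mul (d : A →+ A) (hd : ∀ a b, d (a * b) = a * d b + b * d a) (f g : A[X]) :
    coeffMap d (f * g) = f * coeffMap d g + g * coeffMap d f := by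
  rw [mul_comm g]
  ext n
  simp only [coeff_coeffMap, coeff_mul, coeff_add, map_sum, ← Finset.sum_add_distrib, hd]
  exact Finset.sum_congr rfl fun _ _ => by ring

lemma coeffMap_X (d : A →+ A) (hd : d 1 = 0) : coeffMap d (X : A[X]) = 0 := by
  rw [← monomial_one_one_eq_X, coeffMap_monomial, hd, monomial_zero_right]

end CoefficientMap

section VectorField

variable {k : Type*} [Field k]

/-- The cubic `X (X - 1) (X - t)`. -/
noncomputable def cubic (t : k) : k[X] := X * (X - 1) * (X - C t)

/-- The part of the Hamiltonian of the sixth Painlevé equation linear in the momentum. -/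
noncomputable def quad (t a b c : k) : k[X] :=
  C a * ((X - 1) * (X - C t)) + C b * (X * (X - C t)) + C (c - 1) * (X * (X - 1))

/-- The Hamiltonian vector field of the sixth Painlevé equation, multiplied by `t (t - 1)`, on
polynomials in the momentum with coefficients polynomials in the position. -/
noncomputable def hamField (d : k →+ k) (t a b c e : k) (F : k[X][X]) : k[X][X] :=
  C (C (t * (t - 1))) * coeffMap (coeffMap d) F +
    (C (2 * cubic t) * X - C (quad t a b c)) * coeffMap derivative.toAddMonoidHom F +
    (-(C (derivative (cubic t)) * X ^ 2) + C (derivative (quad t a b c)) * X - C (C e)) *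
      derivative F

lemma zcoeff_hamField (d : k →+ k) (t a b c e : k) (F : k[X][X]) (j : ℤ) :
    zcoeff (hamField d t a b c e F) j =
      C (t * (t - 1)) * coeffMap d (zcoeff F j) +
      2 * cubic t * derivative (zcoeff F (j - 1)) - quad t a b c * derivative (zcoeff F j) -
      (j - 1) * derivative (cubic t) * zcoeff F (j - 1) +
      j * derivative (quad t a b c) * zcoeff F j - (j + 1) * C e * zcoeff F (j + 1) := by
  have : hamField d t a b c e F = C (C (t * (t - 1))) * coeffMap (coeffMap d) F +
      (C (2 * cubic t) * (X * coeffMap derivative.toAddMonoidHom F) -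
        C (quad t a b c) * coeffMap derivative.toAddMonoidHom F) +
      (-(C (derivative (cubic t)) * (X * (X * derivative F))) +
        C (derivative (quad t a b c)) * (X * derivative F) - C (C e) * derivative F) := by
    rw [hamField]
    ring
  rw [this]
  simp only [zcoeff_add, zcoeff_sub, zcoeff_neg, zcoeff_C_mul, zcoeff_X_mul, zcoeff_derivative,
    zcoeff_coeffMap, sub_add_cancel, LinearMap.toAddMonoidHom_coe]
  push_cast
  ring

/-- An invariant polynomial has a cofactor of degree at most one in the momentum. -/
lemma exists_linear_cofactor (d : k →+ k) (t a b c e : k) (F : k[X][X])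
    (hF : F ∣ hamField d t a b c e F) :
    ∃ G₁ G₀ : k[X], ∀ j : ℤ, zcoeff (hamField d t a b c e F) j =
      G₁ * zcoeff F (j - 1) + G₀ * zcoeff F j := by
  obtain ⟨G, hG⟩ := hF
  rcases eq_or_ne F 0 with rfl | hF0
  · exact ⟨0, 0, by simp [hG]⟩
  rcases eq_or_ne G 0 with rfl | hG0
  · exact ⟨0, 0, by simp [hG]⟩
  have hdeg : (hamField d t a b c e F).natDegree ≤ F.natDegree + 1 := by
    refine natDegree_le_of_zcoeff _ _ fun j hj => ?_
    push_cast at hj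
    rw [zcoeff_hamField, zcoeff_of_natDegree_lt F (i := j) (by omega),
      zcoeff_of_natDegree_lt F (i := j - 1) (by omega),
      zcoeff_of_natDegree_lt F (i := j + 1) (by omega)]
    simp
  rw [hG, natDegree_mul hF0 hG0] at hdeg
  obtain ⟨u, v, rfl⟩ := exists_eq_X_add_C_of_natDegree_le_one (show G.natDegree ≤ 1 by omega)
  refine ⟨u, v, fun j => ?_⟩
  rw [hG, show F * (C u * X + C v) = C u * (X * F) + C v * F by ring]
  simp

end VectorField

section LeadingCoefficient

variable {k : Type*} [Field k]

lemma dvd_mul_derivative_of_linear_mul {P g : k[X]} {r : k} (hr : X - C r ∣ P)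
    (h : (X - C r) * g ∣ P * derivative ((X - C r) * g)) : g ∣ P * derivative g := by
  obtain ⟨Q, rfl⟩ := hr
  obtain ⟨w, hw⟩ := h
  refine ⟨w - Q, mul_left_cancel₀ (X_sub_C_ne_zero r) ?_⟩
  simp only [derivative_mul, derivative_X_sub_C] at hw
  linear_combination hw

/-- A polynomial dividing the product of its derivative with a cubic has no roots besides those
of the cubic. -/
lemma exists_factorization [CharZero k] (t : k) (f : k[X]) (hf : f.Monic)
    (h : f ∣ cubic t * derivative f) :
    ∃ a b m : ℕ, f = X ^ a * (X - 1) ^ b * (X - C t) ^ m := by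
  induction hn : f.natDegree generalizing f with
  | zero => exact ⟨0, 0, 0, by simpa using hf.natDegree_eq_zero.mp hn⟩
  | succ n ih =>
    have step : ∀ r : k, X - C r ∣ cubic t → f.IsRoot r →
        ∃ a b m : ℕ, f = (X - C r) * (X ^ a * (X - 1) ^ b * (X - C t) ^ m) := by
      intro r hr hroot
      obtain ⟨g, rfl⟩ := dvd_iff_isRoot.mpr hroot
      have hg : g.Monic := (monic_X_sub_C r).of_mul_monic_left hf
      obtain ⟨a, b, m, hfac⟩ := ih g hg (dvd_mul_derivative_of_linear_mul hr h) (by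
        rw [(monic_X_sub_C r).natDegree_mul hg, natDegree_X_sub_C] at hn; omega)
      exact ⟨a, b, m, by rw [← hfac]⟩
    by_cases h0 : f.IsRoot 0
    · obtain ⟨a, b, m, e⟩ := step 0 (by simp [cubic, mul_assoc]) h0
      exact ⟨a + 1, b, m, by rw [e, C_0]; ring⟩
    by_cases h1 : f.IsRoot 1
    · obtain ⟨a, b, m, e⟩ := step 1 ⟨X * (X - C t), by rw [cubic, C_1]; ring⟩ h1
      exact ⟨a, b + 1, m, by rw [e, C_1]; ring⟩
    by_cases ht : f.IsRoot t
    · obtain ⟨a, b, m, e⟩ := step t (by simp [cubic]) ht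
      exact ⟨a, b, m + 1, by rw [e]; ring⟩
    have cop : ∀ r : k, ¬ f.IsRoot r → IsCoprime f (X - C r) := fun r hr =>
      ((irreducible_X_sub_C r).coprime_iff_not_dvd.mpr (by rwa [dvd_iff_isRoot])).symm
    have hcop : IsCoprime f (cubic t) := by
      have c0 := cop 0 h0
      have c1 := cop 1 h1
      rw [C_0, sub_zero] at c0
      rw [C_1] at c1
      exact (c0.mul_right c1).mul_right (cop t ht)
    have hd := hcop.dvd_of_dvd_mul_left h
    have : derivative f = 0 := by
      by_contra hne
      have := natDegree_le_of_dvd hd hne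
      have := natDegree_derivative_lt (p := f) (by omega)
      omega
    rw [derivative_eq_zero.mp this] at hn
    omega

/-- Divisibility forced by a singular first order linear equation at a simple zero `r` of `P`. -/
lemma pow_dvd_of_pow_dvd_linear_ode [CharZero k] {P Q B S : k[X]} {r : k} {a : ℕ}
    (hP : P = (X - C r) * Q) (hQ : Q.eval r ≠ 0) (hB : B.eval r = a * Q.eval r)
    (h : (X - C r) ^ a ∣ 2 * P * derivative S - derivative P * S - 2 * B * S) :
    (X - C r) ^ a ∣ S := by
  rcases eq_or_ne S 0 with rfl | hS
  · simp
  rw [← le_rootMultiplicity_iff hS]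
  by_contra! hlt
  obtain ⟨u, hu, hur⟩ := exists_eq_pow_rootMultiplicity_mul_and_not_dvd S hS r
  set e := rootMultiplicity r S
  have hpow : (X - C r) * derivative ((X - C r) ^ e) = (e : k[X]) * (X - C r) ^ e := by
    cases e with
    | zero => simp
    | succ n => rw [derivative_X_sub_C_pow]; simp; ring
  have hd : (X - C r) ^ e * (X - C r) ∣ (X - C r) ^ e *
      (2 * (e : k[X]) * Q * u + 2 * P * derivative u - derivative P * u - 2 * B * u) := by
    rw [← pow_succ]
    refine ((pow_dvd_pow _ hlt).trans h).trans (dvd_of_eq ?_)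
    rw [hu, derivative_mul, hP]
    linear_combination 2 * Q * u * hpow
  have hd' := (mul_dvd_mul_iff_left (pow_ne_zero _ (X_sub_C_ne_zero r))).mp hd
  rw [dvd_iff_isRoot] at hd' hur
  simp only [hP, IsRoot, eval_sub, eval_add, eval_mul, derivative_mul, derivative_X_sub_C, eval_X,
    eval_C, eval_natCast, hB, eval_ofNat, eval_one] at hd'
  have h2 : (2 * (e : k) - 1 - 2 * a) * (Q.eval r * u.eval r) = 0 := by linear_combination hd'
  rcases mul_eq_zero.mp h2 with h3 | h3
  · have : (2 * (e : ℤ) - 1 - 2 * a) = 0 := by exact_mod_cast h3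
    omega
  · exact mul_ne_zero hQ hur h3

/-- The logarithmic derivative of `X ^ a * (X - 1) ^ b * (X - t) ^ m` times the cubic. -/
noncomputable def logQuad (t : k) (a b m : ℕ) : k[X] :=
  (a : k[X]) * ((X - 1) * (X - C t)) + (b : k[X]) * (X * (X - C t)) + (m : k[X]) * (X * (X - 1))

lemma linear_mul_derivation_pow (δ : k[X] → k[X])
    (hδ : ∀ f g, δ (f * g) = f * δ g + g * δ f) (ℓ : k[X]) (n : ℕ) :
    ℓ * δ (ℓ ^ n) = n * ℓ ^ n * δ ℓ := by
  have h1 : δ 1 = 0 := by simpa using hδ 1 1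
  induction n with
  | zero => simp [h1]
  | succ n ih =>
    rw [pow_succ, hδ]
    push_cast
    linear_combination ℓ * ih

lemma cubic_mul_derivation (t : k) (a b m : ℕ) (δ : k[X] → k[X])
    (hδ : ∀ f g, δ (f * g) = f * δ g + g * δ f) :
    cubic t * δ (X ^ a * (X - 1) ^ b * (X - C t) ^ m) =
      ((a : k[X]) * ((X - 1) * (X - C t)) * δ X + (b : k[X]) * (X * (X - C t)) * δ (X - 1) +
        (m : k[X]) * (X * (X - 1)) * δ (X - C t)) * (X ^ a * (X - 1) ^ b * (X - C t) ^ m) := by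
  have h0 := linear_mul_derivation_pow δ hδ X a
  have h1 := linear_mul_derivation_pow δ hδ (X - 1) b
  have ht := linear_mul_derivation_pow δ hδ (X - C t) m
  rw [hδ, hδ, cubic]
  linear_combination (X - 1) * (X - C t) * (X - 1) ^ b * (X - C t) ^ m * h0 +
    X * (X - C t) * X ^ a * (X - C t) ^ m * h1 + X * (X - 1) * X ^ a * (X - 1) ^ b * ht

lemma cubic_mul_derivative_factorization (t : k) (a b m : ℕ) :
    cubic t * derivative (X ^ a * (X - 1) ^ b * (X - C t) ^ m) =
      logQuad t a b m * (X ^ a * (X - 1) ^ b * (X - C t) ^ m) := by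
  rw [cubic_mul_derivation t a b m derivative fun f g => by rw [derivative_mul]; ring, logQuad]
  simp

lemma cubic_mul_coeffMap_factorization (d : k →+ k) (hd : ∀ a b, d (a * b) = a * d b + b * d a)
    (t : k) (hdt : d t = 1) (a b m : ℕ) :
    cubic t * coeffMap d (X ^ a * (X - 1) ^ b * (X - C t) ^ m) =
      -((m : k[X]) * (X * (X - 1))) * (X ^ a * (X - 1) ^ b * (X - C t) ^ m) := by
  have h1 : d 1 = 0 := by simpa using hd 1 1
  have h1' : coeffMap d (1 : k[X]) = 0 := by rw [← C_1, coeffMap_C, h1, C_0]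
  rw [cubic_mul_derivation t a b m _ (coeffMap_mul d hd)]
  simp [coeffMap_X d h1, h1', hdt]

lemma eval_derivative_cubic (t x : k) :
    (derivative (cubic t)).eval x = (x - 1) * (x - t) + x * (x - t) + x * (x - 1) := by
  simp [cubic]; ring

/-- The trace of the momentum over the position has residues at `0`, `1` and `t` determined by the
factorization of the leading coefficient; together they give its residue at infinity. -/
lemma subleading_coeff_eq [CharZero k] (d : k →+ k) (hd : ∀ a b, d (a * b) = a * d b + b * d a)
    {t : k} (hdt : d t = 1) (ht0 : t ≠ 0) (ht1 : t ≠ 1) (κ₀ κ₁ θ : k) {a b m N : ℕ} {f g G₀ : k[X]}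
    (hf : f = X ^ a * (X - 1) ^ b * (X - C t) ^ m)
    (hg : ∀ i : ℤ, (f.natDegree : ℤ) ≤ i → zcoeff g i = 0)
    (h : C (t * (t - 1)) * coeffMap d f + 2 * cubic t * derivative g -
        quad t κ₀ κ₁ θ * derivative f - (N - 1) * derivative (cubic t) * g +
        N * derivative (quad t κ₀ κ₁ θ) * f =
      (2 * logQuad t a b m - N * derivative (cubic t)) * g + G₀ * f) :
    zcoeff g (f.natDegree - 1) = -(a * κ₀ + b * κ₁ + m * θ) := by
  have hfm : f.Monic := by
    rw [hf]
    exact ((monic_X_pow a).mul ((monic_X_sub_C (1 : k)).pow b)).mul ((monic_X_sub_C t).pow m)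
  have hP0 : cubic t = (X - C 0) * ((X - 1) * (X - C t)) := by rw [cubic, C_0]; ring
  have hP1 : cubic t = (X - C 1) * (X * (X - C t)) := by rw [cubic, C_1]; ring
  have hPt : cubic t = (X - C t) * (X * (X - 1)) := by rw [cubic]; ring
  have hPf := cubic_mul_derivative_factorization t a b m
  have hPd := cubic_mul_coeffMap_factorization d hd t hdt a b m
  rw [← hf] at hPf hPd
  obtain ⟨E, hE⟩ : ∃ E, E = cubic t * (G₀ - (N : k[X]) * derivative (quad t κ₀ κ₁ θ)) +
    quad t κ₀ κ₁ θ * logQuad t a b m + C (t * (t - 1)) * ((m : k[X]) * (X * (X - 1))) := ⟨_, rfl⟩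
  have hS : 2 * cubic t * derivative (cubic t * g) - derivative (cubic t) * (cubic t * g) -
      2 * logQuad t a b m * (cubic t * g) = f * E := by
    rw [derivative_mul, hE]
    linear_combination cubic t * h + quad t κ₀ κ₁ θ * hPf - C (t * (t - 1)) * hPd
  have ht1' : t - 1 ≠ 0 := sub_ne_zero.mpr ht1
  have ht1'' : 1 - t ≠ 0 := sub_ne_zero.mpr ht1.symm
  have hfS : f ∣ cubic t * g := by
    have d0 : (X - C 0) ^ a ∣ cubic t * g :=
      pow_dvd_of_pow_dvd_linear_ode hP0 (by simpa using ht0) (B := logQuad t a b m)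
        (by simp [logQuad])
        (by rw [hS]; refine Dvd.dvd.mul_right ?_ E
            rw [hf, C_0, sub_zero, mul_assoc]; exact dvd_mul_right _ _)
    have d1 : (X - C 1) ^ b ∣ cubic t * g :=
      pow_dvd_of_pow_dvd_linear_ode hP1 (by simpa using ht1'') (B := logQuad t a b m)
        (by simp [logQuad])
        (by rw [hS]; refine Dvd.dvd.mul_right ?_ E
            rw [hf, C_1, mul_comm (X ^ a), mul_assoc]; exact dvd_mul_right _ _)
    have dt : (X - C t) ^ m ∣ cubic t * g :=
      pow_dvd_of_pow_dvd_linear_ode hPt (by simpa using ⟨ht0, ht1'⟩) (B := logQuad t a b m)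
        (by simp [logQuad])
        (by rw [hS]; refine Dvd.dvd.mul_right ?_ E
            rw [hf]; exact dvd_mul_left _ _)
    have cop : ∀ r s : k, r ≠ s → ∀ i j : ℕ, IsCoprime ((X - C r) ^ i) ((X - C s) ^ j) :=
      fun r s hrs i j => (pairwise_coprime_X_sub_C Function.injective_id hrs).pow
    have c := ((cop 0 t ht0.symm a m).mul_left (cop 1 t ht1.symm b m)).mul_dvd
      ((cop 0 1 zero_ne_one a b).mul_dvd d0 d1) dt
    rwa [C_0, C_1, sub_zero, ← hf] at c
  obtain ⟨T, hT⟩ := hfS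
  have hTE : 2 * cubic t * derivative T - derivative (cubic t) * T = E := by
    refine mul_left_cancel₀ hfm.ne_zero ?_
    rw [hT, derivative_mul] at hS
    linear_combination hS - 2 * T * hPf
  have hzS : ∀ i : ℤ, zcoeff (cubic t * g) i =
      zcoeff g (i - 3) - (1 + t) * zcoeff g (i - 2) + t * zcoeff g (i - 1) := by
    intro i
    rw [show cubic t * g = X * (X * (X * g)) - C (1 + t) * (X * (X * g)) + C t * (X * g) by
      rw [cubic, C_add, C_1]; ring]
    simp only [zcoeff_add, zcoeff_sub, zcoeff_C_mul, zcoeff_X_mul]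
    ring_nf
  have hTdeg : T.natDegree ≤ 2 := by
    rcases eq_or_ne T 0 with rfl | hT0
    · simp
    have h1 : (cubic t * g).natDegree ≤ f.natDegree + 2 := by
      refine natDegree_le_of_zcoeff _ _ fun i hi => ?_
      push_cast at hi
      rw [hzS, hg _ (by omega), hg _ (by omega), hg _ (by omega)]
      simp
    rw [hT, hfm.natDegree_mul' hT0] at h1
    omega
  have hη : T.coeff 2 = zcoeff g (f.natDegree - 1) := by
    have h1 := coeff_mul_add_eq_of_natDegree_le (le_refl f.natDegree) hTdeg
    have h2 := hzS ((f.natDegree + 2 : ℕ) : ℤ)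
    rw [zcoeff_natCast, hT, h1, hfm.coeff_natDegree, one_mul] at h2
    push_cast at h2
    rw [h2, hg (_ - 2) (by omega), hg (_ - 1) (by omega)]
    ring_nf
  have hTe : ∀ x, T.eval x = T.coeff 0 + T.coeff 1 * x + T.coeff 2 * x ^ 2 := by
    intro x
    rw [eval_eq_sum_range' (Nat.lt_succ_of_le hTdeg)]
    simp [Finset.sum_range_succ]
  have e : ∀ x, (cubic t).eval x = 0 → -((derivative (cubic t)).eval x * T.eval x) =
      (quad t κ₀ κ₁ θ).eval x * (logQuad t a b m).eval x + t * (t - 1) * (m * (x * (x - 1))) := by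
    intro x hx
    have := congrArg (eval x) hTE
    rw [hE] at this
    simp only [eval_add, eval_sub, eval_mul, hx, eval_C, eval_X, eval_natCast, eval_one] at this
    linear_combination this
  have e0 := e 0 (by simp [cubic])
  have e1 := e 1 (by simp [cubic])
  have et := e t (by simp [cubic])
  simp only [eval_derivative_cubic, hTe, quad, logQuad, eval_add, eval_mul, eval_C, eval_X,
    eval_sub, eval_one, eval_natCast] at e0 e1 et
  rw [← hη]
  have f0 : T.coeff 0 = -(a * κ₀ * t) := by
    apply mul_left_cancel₀ ht0
    linear_combination -e0
  have f1 : T.coeff 0 + T.coeff 1 + T.coeff 2 = -(b * κ₁ * (1 - t)) := by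
    apply mul_left_cancel₀ ht1''
    linear_combination -e1
  have ft : T.coeff 0 + T.coeff 1 * t + T.coeff 2 * t ^ 2 = -(m * θ * (t * (t - 1))) := by
    apply mul_left_cancel₀ (mul_ne_zero ht0 ht1')
    linear_combination -et
  apply mul_left_cancel₀ (mul_ne_zero ht0 ht1')
  linear_combination ft - t * f1 + (t - 1) * f0

end LeadingCoefficient

section Infinity

variable {R : Type*} [CommRing R]

lemma eq_zero_of_zcoeff {f : R[X]} {i : ℤ} (hi : i < 0) (hf : ∀ l, i < l → zcoeff f l = 0) :
    f = 0 := by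
  refine ext_zcoeff fun l => ?_
  rcases lt_or_ge l 0 with h | h
  · rw [zcoeff_of_neg _ h, zcoeff_zero]
  · rw [hf _ (by omega), zcoeff_zero]

lemma zcoeff_mul_of_gt {U f : R[X]} {u : ℕ} {i : ℤ} (hU : U.natDegree ≤ u)
    (hf : ∀ l, i < l → zcoeff f l = 0) : ∀ l, u + i < l → zcoeff (U * f) l = 0 := by
  intro l hl
  rcases lt_or_ge i 0 with hi | hi
  · simp [eq_zero_of_zcoeff hi hf]
  · obtain ⟨n, rfl⟩ := Int.eq_ofNat_of_zero_le hi
    have := natDegree_le_of_zcoeff f n hf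
    have := natDegree_mul_le (p := U) (q := f)
    exact zcoeff_of_natDegree_lt _ (by omega)

lemma zcoeff_mul_top {U f : R[X]} {u : ℕ} {i : ℤ} (hU : U.natDegree ≤ u)
    (hf : ∀ l, i < l → zcoeff f l = 0) : zcoeff (U * f) (u + i) = U.coeff u * zcoeff f i := by
  rcases lt_or_ge i 0 with hi | hi
  · simp [eq_zero_of_zcoeff hi hf]
  · obtain ⟨n, rfl⟩ := Int.eq_ofNat_of_zero_le hi
    have := natDegree_le_of_zcoeff f n hf
    rw [← Nat.cast_add, zcoeff_natCast, zcoeff_natCast,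
      coeff_mul_add_eq_of_natDegree_le hU this]

variable {k : Type*} [Field k]

lemma cubic_eq (t : k) : cubic t = X ^ 3 + C (-(1 + t)) * X ^ 2 + C t * X := by
  simp [cubic]; ring

lemma quad_eq (t a b c : k) : quad t a b c =
    C (a + b + c - 1) * X ^ 2 + C (-(a * (1 + t) + b * t + c - 1)) * X + C (a * t) := by
  simp [quad]; ring

lemma logQuad_eq (t : k) (a b m : ℕ) : logQuad t a b m =
    C (a + b + m : k) * X ^ 2 + C (-(a * (1 + t) + b * t + m)) * X + C (a * t) := by
  simp [logQuad]; ring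

lemma exists_max_weight (F : k[X][X]) (hF : F ≠ 0) :
    ∃ (w : ℤ) (j : ℤ), (∀ j l, w + j < l → zcoeff (zcoeff F j) l = 0) ∧
      zcoeff (zcoeff F j) (w + j) ≠ 0 := by
  obtain ⟨j₀, hj₀, hmax⟩ := F.support.exists_max_image
    (fun j => ((F.coeff j).natDegree : ℤ) - j) (support_nonempty.mpr hF)
  refine ⟨(F.coeff j₀).natDegree - j₀, j₀, fun j l hl => ?_, ?_⟩
  · rcases lt_or_ge j 0 with hj | hj
    · rw [zcoeff_of_neg F hj, zcoeff_zero]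
    obtain ⟨n, rfl⟩ := Int.eq_ofNat_of_zero_le hj
    rw [zcoeff_natCast]
    by_cases hn : F.coeff n = 0
    · rw [hn, zcoeff_zero]
    have := hmax n (mem_support_iff.mpr hn)
    exact zcoeff_of_natDegree_lt _ (by omega)
  · rw [zcoeff_natCast, sub_add_cancel, zcoeff_natCast, coeff_natDegree]
    exact leadingCoeff_ne_zero.mpr (mem_support_iff.mp hj₀)

/-- The part of maximal weight of an invariant polynomial at infinity satisfies a three-term
recurrence. -/
lemma weight_recurrence (d : k →+ k) (t κ₀ κ₁ θ e : k) {a b m N : ℕ} {F : k[X][X]} {G₀ : k[X]}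
    (h : ∀ j : ℤ, zcoeff (hamField d t κ₀ κ₁ θ e F) j =
      (2 * logQuad t a b m - N * derivative (cubic t)) * zcoeff F (j - 1) + G₀ * zcoeff F j)
    {w j₀ : ℤ} (hw : ∀ j l, w + j < l → zcoeff (zcoeff F j) l = 0)
    (hj₀ : zcoeff (zcoeff F j₀) (w + j₀) ≠ 0) (j : ℤ) :
    G₀.coeff 1 * zcoeff (zcoeff F j) (w + j) =
      (2 * w - (j - 1) - (2 * (a + b + m) - 3 * N)) * zcoeff (zcoeff F (j - 1)) (w + j - 1) +
      (κ₀ + κ₁ + θ - 1) * (j - w) * zcoeff (zcoeff F j) (w + j) -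
      (j + 1) * e * zcoeff (zcoeff F (j + 1)) (w + j + 1) := by
  have hG : ∀ j : ℤ, G₀ * zcoeff F j = C (t * (t - 1)) * coeffMap d (zcoeff F j) +
      2 * cubic t * derivative (zcoeff F (j - 1)) - quad t κ₀ κ₁ θ * derivative (zcoeff F j) -
      ((j - 1 : k[X]) * derivative (cubic t) +
        (2 * logQuad t a b m - N * derivative (cubic t))) * zcoeff F (j - 1) +
      (j : k[X]) * derivative (quad t κ₀ κ₁ θ) * zcoeff F j -
      C ((j + 1) * e) * zcoeff F (j + 1) := by
    intro j
    have := (zcoeff_hamField d t κ₀ κ₁ θ e F j).symm.trans (h j)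
    rw [show (C ((j + 1) * e) : k[X]) = (j + 1) * C e by simp]
    linear_combination -this
  have hder : ∀ j l : ℤ, w + j - 1 < l → zcoeff (derivative (zcoeff F j)) l = 0 := by
    intro j l hl
    rw [zcoeff_derivative, hw _ _ (by omega), mul_zero]
  have hP : (2 * cubic t).natDegree ≤ 3 := by rw [cubic_eq]; compute_degree
  have hA : (quad t κ₀ κ₁ θ).natDegree ≤ 2 := by rw [quad_eq]; compute_degree
  have hA' : ∀ j : ℤ, ((j : k[X]) * derivative (quad t κ₀ κ₁ θ)).natDegree ≤ 1 := by
    intro j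
    rw [quad_eq]; simp only [derivative_add, derivative_mul, derivative_C, derivative_X_pow,
      derivative_X, zero_mul, zero_add, Nat.cast_ofNat, Nat.add_one_sub_one, pow_one]
    compute_degree
  have hB : ∀ j : ℤ, ((j - 1 : k[X]) * derivative (cubic t) +
        (2 * logQuad t a b m - N * derivative (cubic t))).natDegree ≤ 2 := by
    intro j
    rw [cubic_eq, logQuad_eq]; simp only [derivative_add, derivative_mul, derivative_C,
      derivative_X_pow, derivative_X,
      zero_mul, zero_add, Nat.cast_ofNat, Nat.add_one_sub_one, pow_one]
    compute_degree
  have hhigh : ∀ j l : ℤ, w + j + 1 < l → zcoeff (G₀ * zcoeff F j) l = 0 := by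
    intro j l hl
    rw [hG]
    simp only [zcoeff_add, zcoeff_sub, zcoeff_C_mul, zcoeff_coeffMap]
    rw [hw j l (by omega), zcoeff_mul_of_gt hP (hder (j - 1)) l (by push_cast; omega),
      zcoeff_mul_of_gt hA (hder j) l (by push_cast; omega),
      zcoeff_mul_of_gt (hB j) (hw (j - 1)) l (by push_cast; omega),
      zcoeff_mul_of_gt (hA' j) (hw j) l (by push_cast; omega), hw (j + 1) l (by omega)]
    simp
  have hG₀ : G₀.natDegree ≤ 1 := by
    by_contra! hlt
    have h1 := zcoeff_mul_top (le_refl G₀.natDegree) (hw j₀)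
    rw [hhigh _ _ (by omega)] at h1
    have h2 := (mul_eq_zero.mp h1.symm).resolve_right hj₀
    rw [coeff_natDegree, leadingCoeff_eq_zero] at h2
    simp [h2] at hlt
  have htop := zcoeff_mul_top hG₀ (hw j)
  rw [hG] at htop
  simp only [zcoeff_add, zcoeff_sub, zcoeff_C_mul, zcoeff_coeffMap] at htop
  have e1 := zcoeff_mul_top hP (hder (j - 1))
  have e2 := zcoeff_mul_top hA (hder j)
  have e3 := zcoeff_mul_top (hB j) (hw (j - 1))
  have e4 := zcoeff_mul_top (hA' j) (hw j)
  have c1 : (2 * cubic t).coeff 3 = 2 := by rw [cubic_eq]; compute_degree!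
  have c2 : (quad t κ₀ κ₁ θ).coeff 2 = κ₀ + κ₁ + θ - 1 := by rw [quad_eq]; compute_degree!
  have c3 : ((j - 1 : k[X]) * derivative (cubic t) +
        (2 * logQuad t a b m - N * derivative (cubic t))).coeff 2 =
      (j - 1) * 3 + (2 * (a + b + m) - N * 3) := by
    rw [cubic_eq, logQuad_eq]; simp only [derivative_add, derivative_mul, derivative_C,
      derivative_X_pow, derivative_X,
      zero_mul, zero_add, Nat.cast_ofNat, Nat.add_one_sub_one, pow_one]
    compute_degree!
  have c4 : ((j : k[X]) * derivative (quad t κ₀ κ₁ θ)).coeff 1 =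
      j * ((κ₀ + κ₁ + θ - 1) * 2) := by
    rw [quad_eq]; simp only [derivative_add, derivative_mul, derivative_C, derivative_X_pow,
      derivative_X, zero_mul, zero_add, Nat.cast_ofNat, Nat.add_one_sub_one, pow_one]
    compute_degree!
  rw [c1, zcoeff_derivative] at e1
  rw [c2, zcoeff_derivative] at e2
  rw [c3] at e3
  rw [c4] at e4
  have i1 : ((3 : ℕ) : ℤ) + (w + (j - 1) - 1) = ((1 : ℕ) : ℤ) + (w + j) := by push_cast; ring
  have i2 : ((2 : ℕ) : ℤ) + (w + j - 1) = ((1 : ℕ) : ℤ) + (w + j) := by push_cast; ring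
  have i3 : ((2 : ℕ) : ℤ) + (w + (j - 1)) = ((1 : ℕ) : ℤ) + (w + j) := by push_cast; ring
  rw [i1] at e1
  rw [i2] at e2
  rw [i3] at e3
  rw [e1, e2, e3, e4, hw j _ (by omega), map_zero] at htop
  rw [← htop]
  ring_nf
  push_cast
  ring

end Infinity

section InvariantPolynomials

variable {k : Type*} [Field k]

/-- The exponent of a polynomial solution of a first order linear equation at a singular point. -/
lemma eval_eq_of_linear_ode {h U V Q : k[X]} {r : k} (hh : h ≠ 0)
    (hode : U * h = V * h - (X - C r) * Q * derivative h) :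
    U.eval r = V.eval r - h.rootMultiplicity r * Q.eval r := by
  obtain ⟨u, hu, hur⟩ := exists_eq_pow_rootMultiplicity_mul_and_not_dvd h hh r
  set n := h.rootMultiplicity r
  have hpow : (X - C r) * derivative ((X - C r) ^ n) = (n : k[X]) * (X - C r) ^ n := by
    have := linear_mul_derivation_pow derivative (fun f g => by rw [derivative_mul]; ring)
      (X - C r) n
    rwa [derivative_X_sub_C, mul_one] at this
  have key : U * u = V * u - Q * ((n : k[X]) * u + (X - C r) * derivative u) := by
    refine mul_left_cancel₀ (pow_ne_zero n (X_sub_C_ne_zero r)) ?_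
    rw [hu, derivative_mul] at hode
    linear_combination hode - Q * u * hpow
  rw [dvd_iff_isRoot] at hur
  refine mul_right_cancel₀ hur ?_
  have := congrArg (eval r) key
  simp only [eval_mul, eval_sub, eval_add, eval_natCast, eval_X, eval_C] at this
  linear_combination this

/-- An invariant polynomial of positive degree in the momentum forces an integral linear relation
between the parameters. -/
theorem relation_of_invariant [CharZero k] (d : k →+ k) (hd : ∀ a b, d (a * b) = a * d b + b * d a)
    {t : k} (hdt : d t = 1) (ht0 : t ≠ 0) (ht1 : t ≠ 1) {κ₀ κ₁ θ κ s : k}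
    (hs : s = κ₀ + κ₁ + θ - 1) {F : k[X][X]} (hFm : F.leadingCoeff.Monic)
    (hF : F ∣ hamField d t κ₀ κ₁ θ ((s ^ 2 - κ ^ 2) / 4) F) :
    ∃ a b m n : ℕ, 2 * (a * κ₀ + b * κ₁ + m * θ) = (2 * n - F.natDegree) * κ +
      F.natDegree * s := by
  obtain ⟨G₁, G₀, hG⟩ := exists_linear_cofactor _ _ _ _ _ _ _ hF
  set e := (s ^ 2 - κ ^ 2) / 4 with he
  obtain ⟨N, hN⟩ : ∃ N, N = F.natDegree := ⟨_, rfl⟩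
  rw [← hN]
  obtain ⟨f, hf⟩ : ∃ f, f = F.leadingCoeff := ⟨_, rfl⟩
  rw [← hf] at hFm
  have hfN : zcoeff F N = f := by rw [zcoeff_natCast, hf, hN]; rfl
  have hFbig : ∀ j : ℤ, N < j → zcoeff F j = 0 := fun j hj =>
    zcoeff_of_natDegree_lt _ (by omega)
  have hlead := (zcoeff_hamField d t κ₀ κ₁ θ e F (N + 1)).symm.trans (hG (N + 1))
  rw [hFbig (N + 1) (by omega), hFbig (N + 1 + 1) (by omega), add_sub_cancel_right, hfN] at hlead
  simp only [map_zero, mul_zero, add_zero, zero_add, sub_zero] at hlead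
  push_cast at hlead
  obtain ⟨a, b, m, hfac⟩ := exists_factorization t f hFm
    ⟨C (1 / 2) * (G₁ + (N : k[X]) * derivative (cubic t)), by
      have h2 : (C (1 / 2) : k[X]) * 2 = 1 := by rw [← C_ofNat, ← C_mul]; simp
      linear_combination C (1 / 2) * hlead - cubic t * derivative f * h2⟩
  have hG₁ : G₁ = 2 * logQuad t a b m - (N : k[X]) * derivative (cubic t) := by
    have := cubic_mul_derivative_factorization t a b m
    rw [← hfac] at this
    refine mul_right_cancel₀ hFm.ne_zero ?_
    linear_combination 2 * this - hlead
  subst hG₁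
  have hfdeg : f.natDegree = a + b + m := by
    have h1 : (X - 1 : k[X]).Monic := monic_X_sub_C (1 : k)
    have h1' : (X - 1 : k[X]).natDegree = 1 := natDegree_X_sub_C (1 : k)
    rw [hfac, ((monic_X_pow a).mul (h1.pow b)).natDegree_mul ((monic_X_sub_C t).pow m),
      (monic_X_pow a).natDegree_mul (h1.pow b), h1.natDegree_pow, natDegree_X_pow,
      (monic_X_sub_C t).natDegree_pow, natDegree_X_sub_C, h1', mul_one, mul_one]
  obtain ⟨w, j₀, hw, hj₀⟩ := exists_max_weight F (by rintro rfl; simp [hf] at hFm)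
  have hrec := weight_recurrence d t κ₀ κ₁ θ e hG hw hj₀
  rw [← hs] at hrec
  obtain ⟨c, hc⟩ : ∃ c : ℤ → k, ∀ j, c j = zcoeff (zcoeff F j) (w + j) := ⟨_, fun _ => rfl⟩
  have hrec' : ∀ j : ℤ, G₀.coeff 1 * c j = (2 * w - (j - 1) - (2 * (a + b + m) - 3 * N)) *
      c (j - 1) + s * (j - w) * c j - (j + 1) * e * c (j + 1) := by
    intro j
    rw [hc, hc, hc, ← add_sub_assoc, ← add_assoc]
    exact hrec j
  obtain ⟨h, hh⟩ : ∃ h : k[X], ∀ j : ℤ, zcoeff h j = c j := by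
    refine ⟨∑ i ∈ Finset.range (N + 1), monomial i (c i), fun j => ?_⟩
    rcases lt_or_ge j 0 with hj | hj
    · rw [zcoeff_of_neg _ hj, hc, zcoeff_of_neg F hj, zcoeff_zero]
    obtain ⟨i, rfl⟩ := Int.eq_ofNat_of_zero_le hj
    rw [zcoeff_natCast, finsetSum_coeff]
    simp only [coeff_monomial, Finset.sum_ite_eq', Finset.mem_range]
    split_ifs with hi
    · rfl
    · rw [hc, hFbig _ (by omega), zcoeff_zero]
  have hh0 : h ≠ 0 := by
    rintro rfl
    exact hj₀ (by rw [← hc, ← hh, zcoeff_zero])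
  have hhN : h.natDegree ≤ N := natDegree_le_of_zcoeff _ _ fun j hj => by
    rw [hh, hc, hFbig _ hj, zcoeff_zero]
  have htop : 2 * w = h.natDegree + 2 * (a + b + m) - 3 * N := by
    have h1 := hrec' (h.natDegree + 1)
    rw [← hh, ← hh, ← hh, add_sub_cancel_right,
      zcoeff_of_natDegree_lt h (i := h.natDegree + 1) (by omega),
      zcoeff_of_natDegree_lt h (i := h.natDegree + 1 + 1) (by omega), zcoeff_natCast,
      coeff_natDegree] at h1
    push_cast at h1
    have h2 : ((2 * w - h.natDegree - (2 * (a + b + m) - 3 * N) : ℤ) : k) = 0 := by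
      refine mul_right_cancel₀ (leadingCoeff_ne_zero.mpr hh0) ?_
      push_cast
      linear_combination -h1
    have := Int.cast_eq_zero.mp h2
    omega
  have hfw : ((a + b + m : ℕ) : ℤ) ≤ w + N := by
    by_contra! hlt
    have := hw N _ hlt
    rw [hfN, zcoeff_natCast, ← hfdeg, hFm.coeff_natDegree] at this
    exact one_ne_zero this
  push_cast at hfw
  have hwN : w = a + b + m - N := by omega
  have hcN : c N = 1 := by
    rw [hc, hfN, show w + (N : ℤ) = (f.natDegree : ℕ) by rw [hfdeg, hwN]; push_cast; ring,
      zcoeff_natCast, hFm.coeff_natDegree]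
  have hsub := subleading_coeff_eq d hd hdt ht0 ht1 κ₀ κ₁ θ hfac (g := zcoeff F (N - 1))
    (G₀ := G₀) (N := N) (fun i hi => hw _ _ (by rw [hfdeg] at hi; push_cast at hi; omega)) (by
      have := (zcoeff_hamField d t κ₀ κ₁ θ e F N).symm.trans (hG N)
      rw [hfN, hFbig (N + 1) (by omega), mul_zero, sub_zero] at this
      push_cast at this
      exact this)
  have hη : c (N - 1) = -(a * κ₀ + b * κ₁ + m * θ) := by
    rw [← hsub, hc, hfdeg, hwN]
    push_cast
    ring_nf
  have hg0 := hrec' N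
  rw [hcN, hη, hc (N + 1), hFbig (N + 1) (by omega), zcoeff_zero, hwN] at hg0
  have hode : (C (2 * (a + b + m) - 3 * N : k) * X + C (G₀.coeff 1)) * h =
      C (w : k) * (2 * X - C s) * h -
        (X - C ((s + κ) / 2)) * (X - C ((s - κ) / 2)) * derivative h := by
    have e1 : (X - C ((s + κ) / 2)) * (X - C ((s - κ) / 2)) = X ^ 2 - C s * X + C e := by
      have h1 : (C ((s + κ) / 2) : k[X]) + C ((s - κ) / 2) = C s := by rw [← C_add]; congr 1; ring
      have h2 : (C ((s + κ) / 2) : k[X]) * C ((s - κ) / 2) = C e := by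
        rw [← C_mul, he]; congr 1; ring
      linear_combination h2 - X * h1
    rw [e1]
    refine ext_zcoeff fun j => ?_
    rw [show (C (2 * (a + b + m) - 3 * N : k) * X + C (G₀.coeff 1)) * h =
        C (2 * (a + b + m) - 3 * N : k) * (X * h) + C (G₀.coeff 1) * h by ring,
      show C (w : k) * (2 * X - C s) * h - (X ^ 2 - C s * X + C e) * derivative h =
        C (w : k) * (X * h) + C (w : k) * (X * h) - C (w : k) * (C s * h) -
          X * (X * derivative h) + C s * (X * derivative h) - C e * derivative h by ring]
    simp only [zcoeff_add, zcoeff_sub, zcoeff_C_mul, zcoeff_X_mul, zcoeff_derivative, hh,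
      sub_add_cancel]
    push_cast
    linear_combination hrec' j
  have hexp := eval_eq_of_linear_ode hh0 hode
  simp only [eval_add, eval_mul, eval_sub, eval_C, eval_X, eval_ofNat, hwN] at hexp
  push_cast at hexp hg0
  refine ⟨a, b, m, h.rootMultiplicity ((s + κ) / 2), ?_⟩
  linear_combination 2 * hg0 - 2 * hexp

end InvariantPolynomials

section Kernel

variable {k L : Type*} [Field k] [Field L]

/-- A nonzero prime ideal of `k[X][X]` meeting `k[X]` trivially, given as a kernel, is generated by
a polynomial whose leading coefficient is monic. -/
lemma exists_kernel_generator (ψ : k[X] →+* L) (hψ : Function.Injective ψ) (p : L)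
    {F₀ : k[X][X]} (hF₀ : F₀ ≠ 0) (hp : eval₂ ψ p F₀ = 0) :
    ∃ F : k[X][X], F.leadingCoeff.Monic ∧ 0 < F.natDegree ∧ eval₂ ψ p F = 0 ∧
      ∀ H, eval₂ ψ p H = 0 → F ∣ H := by
  obtain ⟨F, hFker, hFp⟩ := (RingHom.ker_isPrime (eval₂RingHom ψ p)).exists_mem_prime_of_ne_bot
    (fun h => hF₀ (by rw [← Ideal.mem_bot, ← h]; exact hp))
  replace hFker : eval₂ ψ p F = 0 := hFker
  have hdeg : 0 < F.natDegree := by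
    by_contra! h
    rw [eq_C_of_natDegree_le_zero h, eval₂_C, map_eq_zero_iff ψ hψ] at hFker
    rw [eq_C_of_natDegree_le_zero h, hFker, C_0] at hFp
    exact hFp.ne_zero rfl
  have hprim := hFp.irreducible.isPrimitive hdeg.ne'
  let Φ := eval₂RingHom (IsFractionRing.lift (K := FractionRing k[X]) hψ) p
  have hΦ : ∀ H : k[X][X], Φ (H.map (algebraMap k[X] (FractionRing k[X]))) = eval₂ ψ p H := by
    intro H
    simp only [Φ, coe_eval₂RingHom, eval₂_map]
    congr 1
    ext x <;> simp
  have hdvd : ∀ H, eval₂ ψ p H = 0 → F ∣ H := by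
    intro H hH
    refine hprim.dvd_of_fraction_map_dvd_fraction_map (K := FractionRing k[X]) ?_
    by_contra hnd
    obtain ⟨u, v, huv⟩ := ((hprim.irreducible_iff_irreducible_map_fraction_map
      (K := FractionRing k[X])).mp hFp.irreducible).coprime_iff_not_dvd.mpr hnd
    have := congrArg Φ huv
    rw [map_add, map_mul, map_mul, hΦ, hΦ, hFker, hH, map_one] at this
    simp at this
  have hlc : F.leadingCoeff.leadingCoeff ≠ 0 := by simpa using hFp.ne_zero
  have hu : IsUnit (C (C F.leadingCoeff.leadingCoeff⁻¹) : k[X][X]) :=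
    isUnit_C.mpr (isUnit_C.mpr (inv_ne_zero hlc).isUnit)
  refine ⟨C (C F.leadingCoeff.leadingCoeff⁻¹) * F, ?_, ?_, ?_, fun H hH => ?_⟩
  · rw [Monic, leadingCoeff_mul, leadingCoeff_C, leadingCoeff_mul, leadingCoeff_C,
      inv_mul_cancel₀ hlc]
  · rwa [natDegree_C_mul (by simpa using hlc)]
  · rw [eval₂_mul, hFker, mul_zero]
  · exact hu.mul_left_dvd.mpr (hdvd H hH)

end Kernel

section Evaluation

variable {k L : Type*} [Field k] [Field L] [Algebra k L]

lemma derivation_eval₂ {A : Type*} [CommRing A] (D : L →+ L)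
    (hD : ∀ a b, D (a * b) = a * D b + b * D a) (ψ : A →+* L) (δ₁ δ₂ : A →+ A) (p q : L)
    (hψ : ∀ a, D (ψ a) = ψ (δ₁ a) + ψ (δ₂ a) * q) (F : A[X]) :
    D (eval₂ ψ p F) = eval₂ ψ p (coeffMap δ₁ F) + eval₂ ψ p (coeffMap δ₂ F) * q +
      eval₂ ψ p (derivative F) * D p := by
  have hpow : ∀ n : ℕ, D (p ^ n) = n * p ^ (n - 1) * D p := by
    intro n
    induction n with
    | zero => simpa using hD 1 1
    | succ n ih =>
      rw [pow_succ, hD, ih]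
      rcases n with _ | n
      · simp
      · simp only [Nat.add_sub_cancel]; push_cast; ring
  induction F using Polynomial.induction_on' with
  | add f g hf hg => simp only [map_add, eval₂_add, hf, hg]; ring
  | monomial n a =>
    rw [coeffMap_monomial, coeffMap_monomial, derivative_monomial]
    simp only [eval₂_monomial, map_mul, map_natCast]
    rw [hD, hpow, hψ]
    ring

lemma derivation_aeval (D : L →+ L) (hD : ∀ a b, D (a * b) = a * D b + b * D a) (d : k →+ k)
    (hd : ∀ a, D (algebraMap k L a) = algebraMap k L (d a)) (y : L) (f : k[X]) :
    D (aeval y f) = aeval y (coeffMap d f) + aeval y (derivative f) * D y := by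
  have h := derivation_eval₂ D hD (algebraMap k L) d 0 y 0 (fun a => by simp [hd]) f
  rw [mul_zero, add_zero] at h
  exact h

/-- A polynomial relation between the position and the momentum forces a linear relation between
the parameters. -/
theorem relation_of_isAlgebraic [CharZero k] (D : L →+ L)
    (hD : ∀ a b, D (a * b) = a * D b + b * D a) (d : k →+ k)
    (hd : ∀ a, D (algebraMap k L a) = algebraMap k L (d a))
    {t : k} (hdt : d t = 1) (ht0 : t ≠ 0) (ht1 : t ≠ 1) {κ₀ κ₁ θ κ s : k}
    (hs : s = κ₀ + κ₁ + θ - 1) {y p : L} (hy : Transcendental k y)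
    (hDy : algebraMap k L (t * (t - 1)) * D y =
      2 * aeval y (cubic t) * p - aeval y (quad t κ₀ κ₁ θ))
    (hDp : algebraMap k L (t * (t - 1)) * D p = -(aeval y (derivative (cubic t)) * p ^ 2) +
      aeval y (derivative (quad t κ₀ κ₁ θ)) * p - algebraMap k L ((s ^ 2 - κ ^ 2) / 4))
    {F₀ : k[X][X]} (hF₀ : F₀ ≠ 0) (hp : eval₂ (aeval y).toRingHom p F₀ = 0) :
    ∃ a b m n N : ℕ, 0 < N ∧ 2 * (a * κ₀ + b * κ₁ + m * θ) = (2 * n - N) * κ + N * s := by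
  obtain ⟨F, hFm, hN, hF, hmin⟩ := exists_kernel_generator (aeval y).toRingHom
    (transcendental_iff_injective.mp hy) p hF₀ hp
  have hdd : ∀ a b, d (a * b) = a * d b + b * d a := fun a b => by
    apply FaithfulSMul.algebraMap_injective k L
    rw [← hd, map_mul, hD, hd, hd, map_add, map_mul, map_mul]
  have hinv : eval₂ (aeval y).toRingHom p
      (hamField d t κ₀ κ₁ θ ((s ^ 2 - κ ^ 2) / 4) F) = 0 := by
    have h := derivation_eval₂ D hD (aeval y).toRingHom (coeffMap d)
      derivative.toAddMonoidHom p (D y) (derivation_aeval D hD d hd y) F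
    rw [hF, map_zero] at h
    rw [hamField]
    simp only [eval₂_add, eval₂_sub, eval₂_mul, eval₂_C, eval₂_X, eval₂_neg, eval₂_pow]
    simp only [AlgHom.toRingHom_eq_coe, RingHom.coe_coe, aeval_C, map_mul _ (2 : k[X]),
      map_ofNat] at h ⊢
    linear_combination -algebraMap k L (t * (t - 1)) * h -
      eval₂ ((aeval y : k[X] →ₐ[k] L) : k[X] →+* L) p
        (coeffMap derivative.toAddMonoidHom F) * hDy -
      eval₂ ((aeval y : k[X] →ₐ[k] L) : k[X] →+* L) p (derivative F) * hDp
  obtain ⟨a, b, m, n, h⟩ := relation_of_invariant d hdd hdt ht0 ht1 hs hFm (hmin _ hinv)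
  exact ⟨a, b, m, n, F.natDegree, hN, h⟩

lemma isAlgebraic_of_not_algebraicIndependent {x y : L} (hx : Transcendental k x)
    (h : ¬ AlgebraicIndependent k ![x, y]) :
    letI := (aeval (R := k) x).toRingHom.toAlgebra
    IsAlgebraic k[X] y := by
  rw [AlgebraicIndependent.iff_transcendental_adjoin_image (1 : Fin 2)] at h
  have hsub : Subsingleton {j : Fin 2 // j ≠ 1} := ⟨by decide⟩
  have h1 : AlgebraicIndependent k fun j : {j : Fin 2 // j ≠ 1} => ![x, y] j := by
    refine (algebraicIndependent_singleton_iff ⟨0, by decide⟩).mpr ?_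
    exact hx
  have h2 : ![x, y] '' {1}ᶜ = {x} := by
    ext z
    simp [Fin.exists_fin_two, eq_comm]
  rw [h2, Algebra.adjoin_singleton_eq_range_aeval] at h
  have h3 : IsAlgebraic (aeval (R := k) x).range y := by
    by_contra hy
    exact h ⟨h1, hy⟩
  let := (aeval (R := k) x).toRingHom.toAlgebra
  exact h3.of_ringHom_of_comp_eq (aeval (R := k) x).rangeRestrict.toRingHom (RingHom.id L)
    (aeval (R := k) x).rangeRestrict_surjective Function.injective_id rfl

end Evaluation

section Genericity

/-- Square roots of rational affine functions of independent elements satisfy no inhomogeneous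
linear relation. -/
lemma eq_zero_of_linear_relation {ι : Type*} [Fintype ι] [DecidableEq ι] {v κ : ι → ℂ}
    (hv : AlgebraicIndependent ℚ v) {a b : ι → ℚ} (ha : ∀ i, a i ≠ 0)
    (hκ : ∀ i, κ i ^ 2 = a i * v i + b i) {n : ι → ℤ} {N : ℤ}
    (h : ∑ i, n i * κ i + N = 0) (i : ι) : n i = 0 := by
  by_contra hi
  refine hv.transcendental_adjoin (s := {i}ᶜ) (i := i) (by simp) ?_
  set A := Algebra.adjoin ℚ (v '' {i}ᶜ)
  have hκalg : ∀ j, IsAlgebraic A (v j) → IsAlgebraic A (κ j) := fun j hj => by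
    refine IsAlgebraic.of_pow two_pos ?_
    rw [hκ]
    exact ((isAlgebraic_algebraMap (algebraMap ℚ A (a j))).mul hj).add
      (isAlgebraic_algebraMap (algebraMap ℚ A (b j)))
  have hint : ∀ m : ℤ, IsAlgebraic A (m : ℂ) := fun m => isAlgebraic_intCast m
  have hκi : IsAlgebraic A (κ i) := by
    have e : κ i = -(∑ j ∈ Finset.univ.erase i, n j * κ j + N) * ((n i : ℤ) : ℂ)⁻¹ := by
      rw [← Finset.add_sum_erase _ _ (Finset.mem_univ i)] at h
      field_simp
      linear_combination h
    rw [e]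
    refine (IsAlgebraic.add (Subalgebra.sum_mem (Subalgebra.algebraicClosure A ℂ)
      fun j hj => ?_) (hint N)).neg.mul (hint _).inv
    refine (hint _).mul (hκalg j ?_)
    exact isAlgebraic_algebraMap (⟨v j, Algebra.subset_adjoin
      ⟨j, by simpa using Finset.ne_of_mem_erase hj, rfl⟩⟩ : A)
  have e : v i = (κ i ^ 2 - b i) * ((a i : ℚ) : ℂ)⁻¹ := by
    rw [hκ]
    field_simp [Rat.cast_ne_zero.mpr (ha i)]
    ring
  rw [e]
  exact ((hκi.pow 2).sub (isAlgebraic_algebraMap (algebraMap ℚ A (b i)))).mul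
    (isAlgebraic_algebraMap (algebraMap ℚ A (a i))).inv

end Genericity

section Hamiltonian

/-- The second Hamilton equation of the sixth Painlevé equation. -/
lemma momentum_equation {L : Type*} [Field L] [CharZero L] {α β γ δ κ₀ κ₁ θ κ t y q q' p p' : L}
    (h₀ : κ₀ ^ 2 = -2 * β) (h₁ : κ₁ ^ 2 = 2 * γ) (hθ : θ ^ 2 = 1 - 2 * δ) (hκ : κ ^ 2 = 2 * α)
    (ht0 : t ≠ 0) (ht1 : t - 1 ≠ 0) (hy0 : y ≠ 0) (hy1 : y - 1 ≠ 0) (hyt : y - t ≠ 0)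
    (hy : q' = (1 / 2) * (1 / y + 1 / (y - 1) + 1 / (y - t)) * q ^ 2
        - (1 / t + 1 / (t - 1) + 1 / (y - t)) * q
        + (y * (y - 1) * (y - t) / (t ^ 2 * (t - 1) ^ 2))
          * (α + β * t / y ^ 2 + γ * (t - 1) / (y - 1) ^ 2 + δ * t * (t - 1) / (y - t) ^ 2))
    (hp : 2 * (y * (y - 1) * (y - t)) * p = t * (t - 1) * q +
      (κ₀ * ((y - 1) * (y - t)) + κ₁ * (y * (y - t)) + (θ - 1) * (y * (y - 1))))
    (hp' : 2 * (((y - 1) * (y - t) + y * (y - t) + y * (y - 1)) * q - y * (y - 1)) * p +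
        2 * (y * (y - 1) * (y - t)) * p' = (2 * t - 1) * q + t * (t - 1) * q' +
      (κ₀ * ((y - 1) + (y - t)) + κ₁ * (y + (y - t)) + (θ - 1) * (y + (y - 1))) * q -
      κ₀ * (y - 1) - κ₁ * y) :
    t * (t - 1) * p' = -(((y - 1) * (y - t) + y * (y - t) + y * (y - 1)) * p ^ 2) +
      (κ₀ * ((y - 1) + (y - t)) + κ₁ * (y + (y - t)) + (θ - 1) * (y + (y - 1))) * p -
      ((κ₀ + κ₁ + θ - 1) ^ 2 - κ ^ 2) / 4 := by
  have hP : y * (y - 1) * (y - t) ≠ 0 := mul_ne_zero (mul_ne_zero hy0 hy1) hyt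
  have hq' : 2 * (y * (y - 1) * (y - t)) * (t * (t - 1)) ^ 2 * q' =
      (t * (t - 1)) ^ 2 * ((y - 1) * (y - t) + y * (y - t) + y * (y - 1)) * q ^ 2 -
      2 * (t * (t - 1)) * (y * (y - 1)) * ((2 * t - 1) * (y - t) + t * (t - 1)) * q +
      2 * (α * (y * (y - 1) * (y - t)) ^ 2 + β * t * ((y - 1) * (y - t)) ^ 2 +
        γ * (t - 1) * (y * (y - t)) ^ 2 + δ * t * (t - 1) * (y * (y - 1)) ^ 2) := by
    rw [hy]
    field_simp
    ring
  refine mul_left_cancel₀ (mul_ne_zero (show (4 : L) ≠ 0 by norm_num) (pow_ne_zero 2 hP)) ?_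
  linear_combination 2 * (y * (y - 1) * (y - t)) * (t * (t - 1)) * hp' + hq' +
    (-2 * (t * (t - 1)) * (((y - 1) * (y - t) + y * (y - t) + y * (y - 1)) * q - y * (y - 1)) +
      ((y - 1) * (y - t) + y * (y - t) + y * (y - 1)) * (2 * (y * (y - 1) * (y - t)) * p +
        (t * (t - 1) * q + (κ₀ * ((y - 1) * (y - t)) + κ₁ * (y * (y - t)) +
          (θ - 1) * (y * (y - 1))))) -
      2 * (y * (y - 1) * (y - t)) *
        (κ₀ * ((y - 1) + (y - t)) + κ₁ * (y + (y - t)) + (θ - 1) * (y + (y - 1)))) * hp -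
    (y * (y - 1) * (y - t)) ^ 2 * hκ + t * ((y - 1) * (y - t)) ^ 2 * h₀ -
    (t - 1) * (y * (y - t)) ^ 2 * h₁ + t * (t - 1) * (y * (y - 1)) ^ 2 * hθ

end Hamiltonian

end PainleveSix

open Polynomial PainleveSix
/-- Strong minimality part of Proposition 3.18 for generic `P_VI`: for `α, β, γ, δ ∈ ℂ`
algebraically independent over `ℚ`, any solution `y` with `y ∉ {0, 1, t}` of the sixth
Painlevé equation is either algebraic over a differential subfield `K`, or `y, y'` are
algebraically independent over `K`. -/
theorem painleveVI_strongly_minimal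
    (α β γ δ : ℂ) (hind : AlgebraicIndependent ℚ ![α, β, γ, δ])
    (L : Type*) [Field L] [Algebra ℂ L]
    (D : L → L)
    (hD_add : ∀ a b : L, D (a + b) = D a + D b)
    (hD_mul : ∀ a b : L, D (a * b) = a * D b + b * D a)
    (hD_const : ∀ c : ℂ, D (algebraMap ℂ L c) = 0)
    (t : L) (hDt : D t = 1)
    (K : Subfield L)
    (hK_const : ∀ c : ℂ, algebraMap ℂ L c ∈ K)
    (hK_t : t ∈ K)
    (hK_D : ∀ a ∈ K, D a ∈ K)
    (y : L) (hy0 : y ≠ 0) (hy1 : y ≠ 1) (hyt : y ≠ t)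
    (hy : D (D y) = (1 / 2) * (1 / y + 1 / (y - 1) + 1 / (y - t)) * (D y) ^ 2
        - (1 / t + 1 / (t - 1) + 1 / (y - t)) * D y
        + (y * (y - 1) * (y - t) / (t ^ 2 * (t - 1) ^ 2))
          * (algebraMap ℂ L α + algebraMap ℂ L β * t / y ^ 2
            + algebraMap ℂ L γ * (t - 1) / (y - 1) ^ 2
            + algebraMap ℂ L δ * t * (t - 1) / (y - t) ^ 2)) :
    IsAlgebraic K y ∨ AlgebraicIndependent K ![y, D y] := by
  by_contra! ⟨htr, halg⟩
  obtain ⟨κ, hκ⟩ := IsAlgClosed.exists_pow_nat_eq (2 * α) two_pos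
  obtain ⟨κ₀, hκ₀⟩ := IsAlgClosed.exists_pow_nat_eq (-2 * β) two_pos
  obtain ⟨κ₁, hκ₁⟩ := IsAlgClosed.exists_pow_nat_eq (2 * γ) two_pos
  obtain ⟨θ, hθ⟩ := IsAlgClosed.exists_pow_nat_eq (1 - 2 * δ) two_pos
  have : CharZero L := charZero_of_injective_algebraMap (algebraMap ℂ L).injective
  let D' : L →+ L := AddMonoidHom.mk' D hD_add
  have hD1 : D 1 = 0 := by simpa using hD_const 1
  have hD2 : D 2 = 0 := by rw [← one_add_one_eq_two, hD_add, hD1, add_zero]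
  have hDsub : ∀ a b, D (a - b) = D a - D b := map_sub D'
  have ht0 : t ≠ 0 := by rintro rfl; exact zero_ne_one ((map_zero D').symm.trans hDt)
  have ht1 : t ≠ 1 := by rintro rfl; exact zero_ne_one (hD1.symm.trans hDt)
  let d : K →+ K := AddMonoidHom.mk' (fun a => ⟨D a, hK_D a a.2⟩)
    fun a b => Subtype.ext (hD_add a b)
  let σ : ℂ →+* K := (algebraMap ℂ L).codRestrict K hK_const
  have hσ : ∀ c, ((σ c : K) : L) = algebraMap ℂ L c := fun _ => rfl
  let τ : K := ⟨t, hK_t⟩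
  have hτ : (τ : L) = t := rfl
  have hL2 : algebraMap ℂ L 2 = 2 := map_ofNat _ 2
  have hσ2 : σ 2 = 2 := map_ofNat _ 2
  have hK4 : ((4 : K) : L) = 4 := map_ofNat K.subtype 4
  have hcoe : ∀ a : K, algebraMap K L a = a := fun _ => rfl
  obtain ⟨P, hP⟩ : ∃ P, P = y * (y - 1) * (y - t) := ⟨_, rfl⟩
  have hP0 : P ≠ 0 := by
    rw [hP]
    exact mul_ne_zero (mul_ne_zero hy0 (sub_ne_zero.mpr hy1)) (sub_ne_zero.mpr hyt)
  have hcubic : aeval y (cubic τ) = P := by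
    simp [cubic, hP, hcoe, hτ]
  have hquad : aeval y (quad τ (σ κ₀) (σ κ₁) (σ θ)) = algebraMap ℂ L κ₀ * ((y - 1) * (y - t)) +
      algebraMap ℂ L κ₁ * (y * (y - t)) + (algebraMap ℂ L θ - 1) * (y * (y - 1)) := by
    simp [quad, hcoe, hτ, hσ]
  obtain ⟨A, hA⟩ : ∃ A, A = aeval y (quad τ (σ κ₀) (σ κ₁) (σ θ)) := ⟨_, rfl⟩
  obtain ⟨p, hp⟩ : ∃ p, p = (t * (t - 1) * D y + A) * (2 * P)⁻¹ := ⟨_, rfl⟩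
  have hPp : 2 * P * p = t * (t - 1) * D y + A := by
    rw [hp]
    field_simp
  have hmom := hPp
  rw [hA, hquad, hP] at hmom
  have hmom' := congrArg D hmom
  simp only [hD_mul, hD_add, hDsub, hD_const, hD1, hD2, hDt] at hmom'
  have hDp := momentum_equation (κ := algebraMap ℂ L κ) (α := algebraMap ℂ L α)
    (by rw [← map_pow, hκ₀]; simp [hL2]) (by rw [← map_pow, hκ₁]; simp [hL2])
    (by rw [← map_pow, hθ]; simp [hL2]) (by rw [← map_pow, hκ]; simp [hL2]) ht0
    (sub_ne_zero.mpr ht1) hy0 (sub_ne_zero.mpr hy1) (sub_ne_zero.mpr hyt) hy hmom (p' := D p)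
    (by linear_combination hmom')
  have hpalg : ∃ F : K[X][X], F ≠ 0 ∧ eval₂ (aeval y).toRingHom p F = 0 := by
    have hDy := isAlgebraic_of_not_algebraicIndependent htr halg
    let := (aeval (R := K) y).toRingHom.toAlgebra
    have hmap : ∀ f : K[X], IsAlgebraic K[X] (aeval y f) := fun f => isAlgebraic_algebraMap f
    have hT : aeval y (C (τ * (τ - 1))) = t * (t - 1) := by
      simp [hcoe, hτ]
    have h2P : aeval y (2 * cubic τ) = 2 * P := by rw [map_mul, hcubic, map_ofNat]
    have : IsAlgebraic K[X] p := by
      rw [hp, hA, ← hT, ← h2P]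
      exact (((hmap _).mul hDy).add (hmap _)).mul (hmap _).inv
    exact this
  obtain ⟨F, hF0, hF⟩ := hpalg
  obtain ⟨a, b, m, n, N, hN, hrel⟩ := relation_of_isAlgebraic D' hD_mul d (fun _ => rfl)
    (t := τ) (κ₀ := σ κ₀) (κ₁ := σ κ₁) (θ := σ θ) (κ := σ κ) (Subtype.ext hDt)
    (fun h => ht0 (congrArg Subtype.val h)) (fun h => ht1 (congrArg Subtype.val h)) rfl htr
    (p := p)
    (by
      rw [hcubic, hPp, ← hA, add_sub_cancel_right]
      rfl)
    (by
      have e1 : aeval y (derivative (cubic τ)) =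
          (y - 1) * (y - t) + y * (y - t) + y * (y - 1) := by
        simp [cubic, hcoe, hτ]
        ring
      have e2 : aeval y (derivative (quad τ (σ κ₀) (σ κ₁) (σ θ))) =
          algebraMap ℂ L κ₀ * ((y - 1) + (y - t)) + algebraMap ℂ L κ₁ * (y + (y - t)) +
            (algebraMap ℂ L θ - 1) * (y + (y - 1)) := by
        simp [quad, hcoe, hτ, hσ]
        ring
      rw [e1, e2]
      refine Eq.trans ?_ (hDp.trans ?_)
      · rfl
      · simp [hcoe, hσ, hK4])
    hF0 hF
  have hrelC : 2 * (a * κ₀ + b * κ₁ + m * θ) = (2 * n - N) * κ + N * (κ₀ + κ₁ + θ - 1) := by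
    apply σ.injective
    simpa [hσ2] using hrel
  have hsum : ∑ i, ((![N - 2 * n, 2 * a - N, 2 * b - N, 2 * m - N] : Fin 4 → ℤ) i : ℂ) *
      (![κ, κ₀, κ₁, θ] : Fin 4 → ℂ) i + (N : ℤ) = 0 := by
    simp [Fin.sum_univ_four]
    linear_combination hrelC
  have hzero := eq_zero_of_linear_relation hind (a := ![2, -2, 2, -2]) (b := ![0, 0, 0, 1])
    (by simp [Fin.forall_fin_succ])
    (by simp [Fin.forall_fin_succ, hκ, hκ₀, hκ₁, hθ]; ring) hsum
  simp only [hzero, Int.cast_zero, zero_mul, Finset.sum_const_zero, zero_add] at hsum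
  exact hN.ne' (by exact_mod_cast hsum)
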